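/- Let $I \subset \mathbb{R}$ be a compact interval containing distinct interpolation points $\eta_1, \dots, \eta_n \in I$ and a point $\mu \in I$. Suppose $\Phi_1, \dots, \Phi_n : \mathbb{R}^d \to \mathbb{R}^d$ are continuous and uniformly bounded. Then there exists a polynomial curve $X : \mathbb{R} \to \mathbb{R}^d$ of degree at most $n$ with $X(\mu) = x$ and $X'(\eta_i) = \Phi_i(X(\eta_i))$ for all $i = 1, \dots, n$. -/

import Mathlib

open Polynomial Set

/-- A curve `X : ℝ → ℝ^d` is a polynomial curve of degree at most `n` if every
component is (the evaluation of) a polynomial of degree at most `n`. -/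
def IsPolyCurve (d n : ℕ) (X : ℝ → EuclideanSpace ℝ (Fin d)) : Prop :=
  ∃ p : Fin d → Polynomial ℝ,
    (∀ j, (p j).natDegree ≤ n) ∧ ∀ t j, X t j = (p j).eval t

open MeasureTheory

theorem ContractingWith.bijective_id_sub {E : Type*} [NormedAddCommGroup E] [CompleteSpace E]
    {K : NNReal} {g : E → E} (hg : ContractingWith K g) :
    Function.Bijective fun x => x - g x := by
  have hc (y : E) : ContractingWith K fun x => y + g x :=
    ⟨hg.1, LipschitzWith.of_dist_le_mul fun x z => by
      simpa using hg.2.dist_le_mul x z⟩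
  constructor
  · intro x z (hxz : x - g x = z - g z)
    refine (hc (x - g x)).fixedPoint_unique' (sub_add_cancel x (g x)) ?_
    change x - g x + g z = z
    rw [hxz, sub_add_cancel]
  · intro y
    refine ⟨ContractingWith.fixedPoint _ (hc y), ?_⟩
    have h : y + g _ = _ := (hc y).fixedPoint_isFixedPt
    exact sub_eq_of_eq_add h.symm

theorem image_id_sub_eq_of_support_subset {E : Type*} [AddGroup E] {g : E → E} {s : Set E}
    (hg : Function.support g ⊆ s) (hb : Function.Bijective fun x => x - g x) :
    (fun x => x - g x) '' s = s := by
  have hfix {x : E} (hx : x ∉ s) : x - g x = x := by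
    rw [Function.notMem_support.mp (fun h => hx (hg h)), sub_zero]
  refine Subset.antisymm ?_ fun y hy => ?_
  · rintro _ ⟨x, hx, rfl⟩
    by_contra hy
    exact hy (by rwa [hb.1 (hfix hy)])
  · obtain ⟨x, rfl⟩ := hb.2 y
    by_cases hx : x ∈ s
    · exact ⟨x, hx, rfl⟩
    · exact absurd (by simpa only [hfix hx] using hy) hx

theorem ContinuousLinearMap.exists_pos_forall_det_one_sub_pos (E : Type*) [NormedAddCommGroup E]
    [NormedSpace ℝ E] :
    ∃ ε > 0, ∀ A : E →L[ℝ] E, ‖A‖ < ε → 0 < (1 - A).det := by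
  have h1 : (1 : E →L[ℝ] E).det = 1 := LinearMap.det_id
  have h : ∀ᶠ B : E →L[ℝ] E in nhds 1, 0 < B.det :=
    ContinuousLinearMap.continuous_det.continuousAt.eventually
      (by simpa only [h1] using lt_mem_nhds one_pos)
  obtain ⟨ε, hε, h⟩ := Metric.eventually_nhds_iff.mp h
  exact ⟨ε, hε, fun A hA => h (by simpa [dist_eq_norm] using hA)⟩

theorem exists_polynomial_eval_eq_setIntegral {E : Type*} [TopologicalSpace E] [T2Space E]
    [MeasurableSpace E] [OpensMeasurableSpace E] (ν : Measure E) [IsFiniteMeasureOnCompacts ν]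
    {s : Set E} (hs : IsCompact s) (P : C(E, ℝ)[X]) :
    ∃ q : ℝ[X], ∀ t, q.eval t =
      ∫ x in s, P.eval₂ (ContinuousMap.evalAlgHom ℝ ℝ x : C(E, ℝ) →+* ℝ) t ∂ν := by
  refine ⟨∑ i ∈ P.support, C (∫ x in s, P.coeff i x ∂ν) * X ^ i, fun t => ?_⟩
  simp only [eval₂_eq_sum, Polynomial.sum, eval_finsetSum, eval_mul, eval_C, eval_pow, eval_X]
  rw [integral_finsetSum]
  · simp [integral_mul_const]
  · intro i _
    exact (((P.coeff i).continuous.continuousOn).integrableOn_compact hs).mul_const _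

theorem exists_polynomial_eval_eq_setIntegral_det {ι : Type*} [Fintype ι]
    {g : (ι → ℝ) → ι → ℝ} (hg : ContDiff ℝ 1 g) {s : Set (ι → ℝ)} (hs : IsCompact s)
    (c : ℝ) (k : ℕ) :
    ∃ q : ℝ[X], ∀ t, q.eval t = ∫ x in s,
      (1 - t • fderiv ℝ g x).det * (c - ∑ i, (x i - t * g x i) ^ 2) ^ k := by
  classical
  let G (i : ι) : C(ι → ℝ, ℝ) := ⟨fun x => g x i, (continuous_apply i).comp hg.continuous⟩
  have hJ (i j : ι) : Continuous fun x => fderiv ℝ g x (Pi.single j 1) i :=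
    (continuous_apply i).comp ((hg.continuous_fderiv one_ne_zero).clm_apply continuous_const)
  let J : Matrix ι ι C(ι → ℝ, ℝ) := fun i j => ⟨_, hJ i j⟩
  let Y (i : ι) : C(ι → ℝ, ℝ) := ⟨fun x => x i, by fun_prop⟩
  obtain ⟨q, hq⟩ := exists_polynomial_eval_eq_setIntegral volume hs
    ((1 - (X : C(ι → ℝ, ℝ)[X]) • J.map C).det *
      (C (algebraMap ℝ _ c) - ∑ i, (C (Y i) - X * C (G i)) ^ 2) ^ k)
  refine ⟨q, fun t => (hq t).trans (integral_congr_ae (.of_forall fun x => ?_))⟩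
  let φ : C(ι → ℝ, ℝ)[X] →+* ℝ :=
    eval₂RingHom (ContinuousMap.evalAlgHom ℝ ℝ x : C(ι → ℝ, ℝ) →+* ℝ) t
  have hφX : φ X = t := by simp [φ]
  have hφC (u : C(ι → ℝ, ℝ)) : φ (C u) = u x := by simp [φ]
  have hdet : φ (1 - (X : C(ι → ℝ, ℝ)[X]) • J.map C).det = (1 - t • fderiv ℝ g x).det := by
    rw [RingHom.map_det, ContinuousLinearMap.det, ← LinearMap.det_toMatrix']
    congr 1
    ext i j
    have hij : J i j x = fderiv ℝ g x (Pi.single j 1) i := rfl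
    by_cases h : i = j
    · subst h
      simp [LinearMap.toMatrix'_apply, hφX, hφC, hij, mul_comm t]
    · simp [LinearMap.toMatrix'_apply, h, hφX, hφC, hij, mul_comm t]
  change φ _ = _
  rw [map_mul, hdet]
  simp [hφX, hφC, Y, G, mul_comm t]

theorem setIntegral_det_one_sub_fderiv {ι : Type*} [Fintype ι] {g : (ι → ℝ) → ι → ℝ}
    (hg : ContDiff ℝ 1 g) {s : Set (ι → ℝ)} (hs : IsCompact s) (hgs : Function.support g ⊆ s)
    (c : ℝ) (k : ℕ) :
    ∫ x in s, (1 - fderiv ℝ g x).det * (c - ∑ i, (x i - g x i) ^ 2) ^ k =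
      ∫ x in s, (c - ∑ i, x i ^ 2) ^ k := by
  have hgc : HasCompactSupport g := .of_support_subset_isCompact hs hgs
  obtain ⟨C₁, hC₁⟩ := ContDiff.lipschitzWith_of_hasCompactSupport hgc hg one_ne_zero
  obtain ⟨ε, hε, hdet⟩ := ContinuousLinearMap.exists_pos_forall_det_one_sub_pos (ι → ℝ)
  obtain ⟨q, hq⟩ := exists_polynomial_eval_eq_setIntegral_det hg hs c k
  have hsmall : ∀ t ∈ Ioo 0 (min 1 ε / (C₁ + 1)), q.eval t = ∫ x in s, (c - ∑ i, x i ^ 2) ^ k := by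
    rintro t ⟨ht0, ht⟩
    have hC0 : (0 : ℝ) ≤ C₁ := C₁.2
    rw [lt_div_iff₀ (by positivity)] at ht
    have htC : t * C₁ < min 1 ε := by nlinarith
    have hcontr : ContractingWith (t.toNNReal * C₁) fun x => t • g x := by
      refine ⟨?_, LipschitzWith.of_dist_le_mul fun x y => ?_⟩
      · rw [← NNReal.coe_lt_coe]
        simpa [ht0.le] using htC.trans_le (min_le_left _ _)
      · rw [dist_smul₀, Real.norm_of_nonneg ht0.le]
        simpa [ht0.le, mul_assoc] using
          mul_le_mul_of_nonneg_left (hC₁.dist_le_mul x y) ht0.le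
    have hbij := hcontr.bijective_id_sub
    have himage := image_id_sub_eq_of_support_subset
      ((Function.support_const_smul_subset t g).trans hgs) hbij
    have hder (x : ι → ℝ) : HasFDerivAt (fun x => x - t • g x) (1 - t • fderiv ℝ g x) x :=
      (hasFDerivAt_id x).sub (((hg.differentiable one_ne_zero) x).hasFDerivAt.const_smul t)
    have hpos (x : ι → ℝ) : 0 < (1 - t • fderiv ℝ g x).det := by
      refine hdet _ ?_
      rw [norm_smul, Real.norm_of_nonneg ht0.le]
      exact (mul_le_mul_of_nonneg_left (norm_fderiv_le_of_lipschitz ℝ hC₁) ht0.le).trans_lt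
        (htC.trans_le (min_le_right _ _))
    have hcov := integral_image_eq_integral_abs_det_fderiv_smul volume hs.measurableSet
      (fun x _ => (hder x).hasFDerivWithinAt) hbij.1.injOn fun y => (c - ∑ i, y i ^ 2) ^ k
    change (fun x => x - t • g x) '' s = s at himage
    rw [himage] at hcov
    rw [hq, hcov]
    simp [abs_of_pos (hpos _)]
  have hconst : q = C (∫ x in s, (c - ∑ i, x i ^ 2) ^ k) := by
    have hε' : 0 < min 1 ε / (C₁ + 1) := by positivity
    exact eq_of_infinite_eval_eq _ _
      ((Ioo_infinite hε').mono fun t ht => by simpa using hsmall t ht)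
  simpa [hconst] using (hq 1).symm

theorem ContDiff.exists_fixedPoint_of_hasCompactSupport {ι : Type*} [Fintype ι]
    {g : (ι → ℝ) → ι → ℝ} (hg : ContDiff ℝ 1 g) (hgc : HasCompactSupport g) :
    ∃ x, g x = x := by
  by_contra! hne
  obtain ⟨R, hR⟩ := hgc.isCompact.isBounded.subset_closedBall 0
  set s : Set (ι → ℝ) := Metric.closedBall 0 (max R 1)
  have hs : IsCompact s := isCompact_closedBall _ _
  have hgs : Function.support g ⊆ s :=
    (subset_tsupport g).trans (hR.trans (Metric.closedBall_subset_closedBall (le_max_left _ _)))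
  have h0s : s ∈ nhds (0 : ι → ℝ) :=
    Metric.closedBall_mem_nhds _ (one_pos.trans_le (le_max_right _ _))
  have hgcont := hg.continuous
  have hSF : Continuous fun x => ∑ i, (x i - g x i) ^ 2 := by fun_prop
  have hS : Continuous fun x : ι → ℝ => ∑ i, x i ^ 2 := by fun_prop
  obtain ⟨x₀, -, hx₀⟩ := hs.exists_isMinOn ⟨0, mem_of_mem_nhds h0s⟩ hSF.continuousOn
  set δ := ∑ i, (x₀ i - g x₀ i) ^ 2
  have hδ : 0 < δ := by
    refine (Finset.sum_nonneg fun i _ => sq_nonneg _).lt_of_ne' fun h => hne x₀ ?_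
    rw [Finset.sum_eq_zero_iff_of_nonneg fun i _ => sq_nonneg _] at h
    ext i
    exact (sub_eq_zero.mp (pow_eq_zero_iff two_ne_zero |>.mp (h i (Finset.mem_univ i)))).symm
  obtain ⟨c₁, hc₁⟩ := hs.bddAbove_image hSF.continuousOn
  obtain ⟨c₂, hc₂⟩ := hs.bddAbove_image hS.continuousOn
  set c := max (max c₁ c₂) δ
  have hF (x) (hx : x ∈ s) : ∑ i, (x i - g x i) ^ 2 ≤ c :=
    (hc₁ (mem_image_of_mem _ hx)).trans ((le_max_left _ _).trans (le_max_left _ _))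
  have hI (x) (hx : x ∈ s) : ∑ i, x i ^ 2 ≤ c :=
    (hc₂ (mem_image_of_mem _ hx)).trans ((le_max_right _ _).trans (le_max_left _ _))
  have hcδ : δ ≤ c := le_max_right _ _
  have hdetc : Continuous fun x => (1 - fderiv ℝ g x).det :=
    ContinuousLinearMap.continuous_det.comp
      (continuous_const.sub (hg.continuous_fderiv one_ne_zero))
  set D := ∫ x in s, |(1 - fderiv ℝ g x).det|
  set u : Set (ι → ℝ) := s ∩ {x | ∑ i, x i ^ 2 ≤ δ / 2}
  have husub : u ⊆ s := inter_subset_left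
  have hu : IsCompact u := hs.inter_right (isClosed_le hS continuous_const)
  have hV : 0 < volume.real u := by
    have h0 : u ∈ nhds (0 : ι → ℝ) := Filter.inter_mem h0s
      (hS.continuousAt.eventually (Iic_mem_nhds (by simpa using hδ)))
    exact ENNReal.toReal_pos (Measure.measure_pos_of_mem_nhds _ h0).ne' hu.measure_lt_top.ne
  have hle (k : ℕ) : volume.real u * (c - δ / 2) ^ k ≤ D * (c - δ) ^ k := by
    calc volume.real u * (c - δ / 2) ^ k = ∫ x in u, (c - δ / 2) ^ k := by simp
      _ ≤ ∫ x in u, (c - ∑ i, x i ^ 2) ^ k := by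
        refine setIntegral_mono_on ?_ ?_ hu.measurableSet fun x hx => ?_
        · exact continuousOn_const.integrableOn_compact hu
        · exact ((continuous_const.sub hS).pow k).continuousOn.integrableOn_compact hu
        · exact pow_le_pow_left₀ (by linarith) (by linarith [hx.2.out]) k
      _ ≤ ∫ x in s, (c - ∑ i, x i ^ 2) ^ k := by
        refine setIntegral_mono_set (((continuous_const.sub hS).pow k).continuousOn.integrableOn_compact hs) ?_
          husub.eventuallyLE
        filter_upwards [ae_restrict_mem hs.measurableSet] with x hx
        exact pow_nonneg (sub_nonneg.mpr (hI x hx)) k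
      _ = ∫ x in s, (1 - fderiv ℝ g x).det * (c - ∑ i, (x i - g x i) ^ 2) ^ k :=
        (setIntegral_det_one_sub_fderiv hg hs hgs c k).symm
      _ ≤ ∫ x in s, |(1 - fderiv ℝ g x).det| * (c - δ) ^ k := by
        refine setIntegral_mono_on ?_ ?_ hs.measurableSet fun x hx => ?_
        · exact (hdetc.mul ((continuous_const.sub hSF).pow k)).continuousOn.integrableOn_compact hs
        · exact (hdetc.abs.mul continuous_const).continuousOn.integrableOn_compact hs
        · have hnonneg := sub_nonneg.mpr (hF x hx)
          have hδx : δ ≤ ∑ i, (x i - g x i) ^ 2 := hx₀ hx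
          exact mul_le_mul (le_abs_self _) (pow_le_pow_left₀ hnonneg (by linarith) k)
            (pow_nonneg hnonneg k) (abs_nonneg _)
      _ = D * (c - δ) ^ k := integral_mul_const _ _
  have hpos : 0 < c - δ / 2 := by linarith
  have hlim : Filter.Tendsto (fun k => D * ((c - δ) / (c - δ / 2)) ^ k) .atTop (nhds (D * 0)) :=
    (tendsto_pow_atTop_nhds_zero_of_lt_one (div_nonneg (by linarith) hpos.le)
      ((div_lt_one hpos).mpr (by linarith))).const_mul D
  refine hV.not_ge (mul_zero D ▸ ge_of_tendsto' hlim fun k => ?_)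
  rw [div_pow, mul_div_assoc', le_div_iff₀ (pow_pos hpos k)]
  exact hle k

/-- A bounded continuous self-map of `ι → ℝ` has a fixed point. -/
theorem Continuous.exists_fixedPoint_of_bounded {ι : Type*} [Fintype ι]
    {g : (ι → ℝ) → ι → ℝ} (hg : Continuous g) {M : ℝ} (hM : ∀ x, ‖g x‖ ≤ M) :
    ∃ x, g x = x := by
  have hM0 : 0 ≤ M := (norm_nonneg _).trans (hM 0)
  let χ (x : ι → ℝ) : ℝ := max 0 (min 1 (M + 1 - ‖x‖))
  have hχ0 (x) : 0 ≤ χ x := le_max_left _ _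
  have hχ1 (x) : χ x ≤ 1 := max_le zero_le_one (min_le_left _ _)
  let f (x : ι → ℝ) : ι → ℝ := χ x • g x
  have hf : Continuous f := by fun_prop
  set s : Set (ι → ℝ) := Metric.closedBall 0 (M + 1)
  have hs : IsCompact s := isCompact_closedBall _ _
  have h0s : (0 : ι → ℝ) ∈ s := Metric.mem_closedBall_self (by linarith)
  have hfs : Function.support f ⊆ s := by
    intro x hx
    by_contra hxs
    have hxn : M + 1 < ‖x‖ := by simpa [s] using hxs
    have hχx : χ x = 0 := max_eq_left ((min_le_right _ _).trans (by linarith))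
    exact hx (by simp [f, hχx])
  obtain ⟨x₀, -, hmin⟩ := hs.exists_isMinOn ⟨0, h0s⟩ (f := fun x => dist x (f x)) (by fun_prop)
  have hx₀ : f x₀ = x₀ := by
    by_contra hne
    have hpos : 0 < dist x₀ (f x₀) := dist_pos.mpr (Ne.symm hne)
    obtain ⟨p, hp, hpf, hps⟩ := hf.exists_contDiff_approx 1
      (ε := fun _ => dist x₀ (f x₀)) continuous_const fun _ => hpos
    obtain ⟨y, hy⟩ := ContDiff.exists_fixedPoint_of_hasCompactSupport hp
      (.of_support_subset_isCompact hs (hps.trans hfs))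
    have hys : y ∈ s := by
      by_contra hys
      have : p y = 0 := Function.notMem_support.mp fun h => hys (hfs (hps h))
      exact hys (by rwa [← hy, this])
    have hlt := hpf y
    rw [hy] at hlt
    exact (hmin hys).not_gt hlt
  have hxM : ‖x₀‖ ≤ M := by
    rw [← hx₀, norm_smul, Real.norm_of_nonneg (hχ0 _)]
    exact (mul_le_of_le_one_left (norm_nonneg _) (hχ1 _)).trans (hM _)
  have hχx : χ x₀ = 1 := by
    simp only [χ]
    rw [min_eq_left (by linarith), max_eq_right zero_le_one]
  exact ⟨x₀, by simpa [f, hχx] using hx₀⟩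

theorem Polynomial.exists_derivative_eq (p : ℝ[X]) :
    ∃ q : ℝ[X], derivative q = p ∧ q.natDegree ≤ p.natDegree + 1 := by
  refine ⟨∑ k ∈ Finset.range (p.natDegree + 1), C (p.coeff k / (k + 1)) * X ^ (k + 1), ?_, ?_⟩
  · conv_rhs => rw [p.as_sum_range_C_mul_X_pow]
    rw [derivative_sum]
    refine Finset.sum_congr rfl fun k _ => ?_
    have hk : (k : ℝ) + 1 ≠ 0 := by positivity
    rw [derivative_C_mul_X_pow]
    simp [div_mul_cancel₀ _ hk]
  · refine natDegree_sum_le_of_forall_le _ _ fun k hk => ?_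
    exact (natDegree_C_mul_X_pow_le _ _).trans (Finset.mem_range.mp hk)

theorem exists_polynomial_derivative_eval_eq_single {n : ℕ} {η : Fin n → ℝ}
    (hη : Function.Injective η) (μ : ℝ) (k : Fin n) :
    ∃ L : ℝ[X], L.natDegree ≤ n ∧ L.eval μ = 0 ∧
      ∀ i, (derivative L).eval (η i) = if i = k then 1 else 0 := by
  obtain ⟨q, hq, hdeg⟩ := (Lagrange.basis Finset.univ η k).exists_derivative_eq
  have hbasis := Lagrange.natDegree_basis hη.injOn (Finset.mem_univ k)
  have hn : 0 < n := k.pos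
  refine ⟨q - C (q.eval μ), ?_, by simp, fun i => ?_⟩
  · rw [natDegree_sub_C]
    rw [Finset.card_univ, Fintype.card_fin] at hbasis
    omega
  · rw [derivative_sub, derivative_C, sub_zero, hq]
    split_ifs with h
    · rw [h, Lagrange.eval_basis_self hη.injOn (Finset.mem_univ k)]
    · exact Lagrange.eval_basis_of_ne (Ne.symm h) (Finset.mem_univ i)

theorem stmt_0 (d n : ℕ) (a b : ℝ) (hab : a ≤ b)
    (η : Fin n → ℝ) (hη : Function.Injective η)
    (hηI : ∀ i, η i ∈ Set.Icc a b) (μ : ℝ) (hμ : μ ∈ Set.Icc a b)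
    (Φ : Fin n → EuclideanSpace ℝ (Fin d) → EuclideanSpace ℝ (Fin d))
    (hcont : ∀ i, Continuous (Φ i))
    (M : ℝ) (hbd : ∀ i y, ‖Φ i y‖ ≤ M)
    (x : EuclideanSpace ℝ (Fin d)) :
    ∃ X : ℝ → EuclideanSpace ℝ (Fin d), IsPolyCurve d n X ∧
      X μ = x ∧ ∀ i, deriv X (η i) = Φ i (X (η i)) := by
  choose L hdeg hLμ hLη using exists_polynomial_derivative_eval_eq_single hη μ
  let p (z : Fin n × Fin d → ℝ) (j : Fin d) : ℝ[X] := C (x j) + ∑ k, C (z (k, j)) * L k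
  let Y (z : Fin n × Fin d → ℝ) (t : ℝ) : EuclideanSpace ℝ (Fin d) :=
    WithLp.toLp 2 fun j => (p z j).eval t
  have hY (t : ℝ) : Continuous fun z => Y z t := by
    simp only [Y, p, eval_add, eval_C, eval_finsetSum, eval_mul]
    fun_prop
  obtain ⟨z, hz⟩ := Continuous.exists_fixedPoint_of_bounded
    (g := fun z (ij : Fin n × Fin d) => Φ ij.1 (Y z (η ij.1)) ij.2) (M := max M 0)
    (continuous_pi fun ij => (EuclideanSpace.proj (𝕜 := ℝ) ij.2).continuous.comp
      ((hcont ij.1).comp (hY (η ij.1))))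
    (fun z => (pi_norm_le_iff_of_nonneg (le_max_right _ _)).mpr fun ij =>
      (PiLp.norm_apply_le _ _).trans ((hbd _ _).trans (le_max_left _ _)))
  refine ⟨Y z, ⟨p z, fun j => ?_, fun t j => rfl⟩, ?_, fun i => ?_⟩
  · refine natDegree_add_le_of_degree_le (by simp) ?_
    exact natDegree_sum_le_of_forall_le _ _ fun k _ => (natDegree_C_mul_le _ _).trans (hdeg k)
  · ext j
    simp [Y, p, eval_finsetSum, hLμ]
  · have hd : HasDerivAt (Y z) (WithLp.toLp 2 fun j => (derivative (p z j)).eval (η i)) (η i) :=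
      (PiLp.continuousLinearEquiv 2 ℝ fun _ : Fin d => ℝ).symm.hasFDerivAt.comp_hasDerivAt _
        (hasDerivAt_pi.mpr fun j => (p z j).hasDerivAt _)
    rw [hd.deriv]
    ext j
    simpa [p, eval_finsetSum, hLη] using (congrFun hz (i, j)).symm
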